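/- arXiv:2112.06079 — 2 statements merged into one kernel-verified Lean document; each statement's English description precedes it below -/
import Mathlib

section
/- Fix an integer n ≥ 2, c ∈ (0,1), and φ ∈ ℝ. As θ → π/2− (and likewise as θ → −π/2+), the partial derivatives of ρ_c satisfy: (∂ρ_c/∂θ)(θ,φ)/cos θ → 1, (∂ρ_c/∂φ)(θ,φ)/cos²θ → 0, (∂²ρ_c/∂θ∂φ)(θ,φ)/cos θ → 0, and (∂²ρ_c/∂φ²)(θ,φ)/cos²θ → 0. -/
open Real Set Filter Topology

/-- `Fc c x` is the function `F_c(x)` from the paper. -/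
noncomputable def Fc (c x : ℝ) : ℝ :=
  (c * x ^ 2 + (1 - c) * (1 - x) ^ 2 * (c * x / (c + x))) / (c * x + (1 - c) * (1 - x) ^ 2)

/-- `fc c θ = π·F_c(θ/π + 1/2) − π/2`. -/
noncomputable def fc (c θ : ℝ) : ℝ := π * Fc c (θ / π + 1 / 2) - π / 2

/-- `gc c θ = −f_c(−θ)`. -/
noncomputable def gc (c θ : ℝ) : ℝ := -fc c (-θ)

/-- `ac n c θ φ` is the function `a_c(θ,φ)` from the paper. -/
noncomputable def ac (n : ℕ) (c θ φ : ℝ) : ℝ :=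
  Real.cos (n * φ / 2) ^ 2 * Real.cos (fc c θ) ^ 2 /
    (Real.cos (n * φ / 2) ^ 2 * Real.cos (fc c θ) ^ 2 +
      Real.sin (n * φ / 2) ^ 2 * Real.cos (gc c θ) ^ 2)

/-- `ρc n c θ φ` is the function `ρ_c(θ,φ)` from the paper. -/
noncomputable def ρc (n : ℕ) (c θ φ : ℝ) : ℝ :=
  ac n c θ φ * Real.sin (fc c θ) + (1 - ac n c θ φ) * Real.sin (gc c θ)

lemma factor_aux (h : ℝ → ℝ) (x0 : ℝ) (ha : AnalyticAt ℝ h x0) (h0 : h x0 = 0) :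
    ∃ u : ℝ → ℝ, AnalyticAt ℝ u x0 ∧ (∀ x, h x = (x - x0) * u x) ∧ u x0 = deriv h x0 := by
  refine ⟨dslope h x0, ?_, ?_, dslope_same h x0⟩
  · obtain ⟨p, hp⟩ := ha
    exact hp.has_fpower_series_dslope_fslope.analyticAt
  · intro x
    have := sub_smul_dslope h x0 x
    rw [smul_eq_mul, h0, sub_zero] at this
    exact this.symm

/-- denominator -/
noncomputable def dd (n : ℕ) (U V ψ : ℝ) : ℝ :=
  Real.cos (n * ψ / 2) ^ 2 * U + Real.sin (n * ψ / 2) ^ 2 * V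

noncomputable def A0 (n : ℕ) (U V ψ : ℝ) : ℝ := Real.cos (n * ψ / 2) ^ 2 * U / dd n U V ψ

noncomputable def A1 (n : ℕ) (U V ψ : ℝ) : ℝ :=
  (-n * U * V * (Real.cos (n * ψ / 2) * Real.sin (n * ψ / 2))) / dd n U V ψ ^ 2

noncomputable def A2 (n : ℕ) (U V ψ : ℝ) : ℝ :=
  ((-n * U * V * (n / 2 * (Real.cos (n * ψ / 2) ^ 2 - Real.sin (n * ψ / 2) ^ 2)))
      * dd n U V ψ ^ 2 -
    (-n * U * V * (Real.cos (n * ψ / 2) * Real.sin (n * ψ / 2))) *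
      (2 * dd n U V ψ * (n * (V - U) * (Real.cos (n * ψ / 2) * Real.sin (n * ψ / 2)))))
    / (dd n U V ψ ^ 2) ^ 2

lemma dd_pos (n : ℕ) (U V ψ : ℝ) (hU : 0 < U) (hV : 0 < V) : 0 < dd n U V ψ := by
  unfold dd
  have h := Real.cos_sq_add_sin_sq (n * ψ / 2)
  have hc := sq_nonneg (Real.cos (n * ψ / 2))
  have hs := sq_nonneg (Real.sin (n * ψ / 2))
  rcases eq_or_lt_of_le hc with h1 | h1
  · have : Real.sin (n * ψ / 2) ^ 2 = 1 := by linarith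
    rw [this, ← h1]; linarith
  · have := mul_pos h1 hU
    have := mul_nonneg hs hV.le
    linarith

lemma hcosd (n : ℕ) (ψ : ℝ) : HasDerivAt (fun ψ : ℝ => Real.cos (n * ψ / 2))
    (-Real.sin (n * ψ / 2) * (n / 2)) ψ := by
  have h : HasDerivAt (fun ψ : ℝ => (n * ψ / 2 : ℝ)) (n / 2) ψ := by
    simpa using ((hasDerivAt_id ψ).const_mul (n : ℝ)).div_const 2
  exact h.cos

lemma hsind (n : ℕ) (ψ : ℝ) : HasDerivAt (fun ψ : ℝ => Real.sin (n * ψ / 2))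
    (Real.cos (n * ψ / 2) * (n / 2)) ψ := by
  have h : HasDerivAt (fun ψ : ℝ => (n * ψ / 2 : ℝ)) (n / 2) ψ := by
    simpa using ((hasDerivAt_id ψ).const_mul (n : ℝ)).div_const 2
  exact h.sin

lemma hdd (n : ℕ) (U V ψ : ℝ) : HasDerivAt (fun ψ => dd n U V ψ)
    (n * (V - U) * (Real.cos (n * ψ / 2) * Real.sin (n * ψ / 2))) ψ := by
  have := (((hcosd n ψ).pow 2).mul_const U).add (((hsind n ψ).pow 2).mul_const V)
  refine this.congr_deriv ?_
  simp; ring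

lemma hA0 (n : ℕ) (U V ψ : ℝ) (hU : 0 < U) (hV : 0 < V) :
    HasDerivAt (fun ψ => A0 n U V ψ) (A1 n U V ψ) ψ := by
  have hd := (dd_pos n U V ψ hU hV).ne'
  have := (((hcosd n ψ).pow 2).mul_const U).div (hdd n U V ψ) hd
  refine this.congr_deriv ?_
  unfold A1
  congr 1
  have h := Real.cos_sq_add_sin_sq (n * ψ / 2)
  have h2 : Real.cos (n * ψ / 2) ^ 2 = 1 - Real.sin (n * ψ / 2) ^ 2 := by linarith
  simp [dd]
  linear_combination (-(n:ℝ) * U * V * (Real.cos (n * ψ / 2) * Real.sin (n * ψ / 2))) * h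

lemma hA1 (n : ℕ) (U V ψ : ℝ) (hU : 0 < U) (hV : 0 < V) :
    HasDerivAt (fun ψ => A1 n U V ψ) (A2 n U V ψ) ψ := by
  have hd := (dd_pos n U V ψ hU hV).ne'
  have := ((((hcosd n ψ).mul (hsind n ψ)).const_mul (-n * U * V)).div ((hdd n U V ψ).pow 2)
    (pow_ne_zero 2 hd))
  refine this.congr_deriv ?_
  unfold A2
  congr 1
  simp only [Pi.mul_apply, Pi.pow_apply]
  push_cast
  ring

lemma D_aux (θ0 : ℝ) (hcos : Real.cos θ0 = 0) (p q : ℝ → ℝ) (hp : AnalyticAt ℝ p θ0)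
    (hq : AnalyticAt ℝ q θ0) : ∃ w : ℝ → ℝ, AnalyticAt ℝ w θ0 ∧ ∀ θ,
      Real.sin (θ + (θ - θ0) ^ 2 * p θ) - Real.sin (θ + (θ - θ0) ^ 2 * q θ)
        = (θ - θ0) ^ 3 * w θ := by
  obtain ⟨s, hs, hs1, -⟩ := factor_aux Real.sin 0 Real.analyticAt_sin Real.sin_zero
  obtain ⟨r, hr, hr1, -⟩ := factor_aux
    (fun θ => Real.cos (((θ + (θ - θ0) ^ 2 * p θ) + (θ + (θ - θ0) ^ 2 * q θ)) / 2)) θ0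
    (by fun_prop) (by simp [hcos])
  refine ⟨fun θ => r θ * (p θ - q θ) * s ((θ - θ0) ^ 2 * (p θ - q θ) / 2), ?_, ?_⟩
  · have : AnalyticAt ℝ (fun θ => s ((θ - θ0) ^ 2 * (p θ - q θ) / 2)) θ0 := by
      refine AnalyticAt.fun_comp (g := s) (f := fun θ => (θ - θ0) ^ 2 * (p θ - q θ) / 2) ?_ (by fun_prop)
      simpa using hs
    exact (hr.mul (hp.sub hq)).mul this
  · intro θ
    rw [Real.sin_sub_sin, hr1 θ]
    have e : (θ + (θ - θ0) ^ 2 * p θ - (θ + (θ - θ0) ^ 2 * q θ)) / 2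
      = (θ - θ0) ^ 2 * (p θ - q θ) / 2 := by ring
    rw [e, hs1]
    ring

lemma cos_aux (θ0 : ℝ) (hcos : Real.cos θ0 = 0) (p : ℝ → ℝ) (hp : AnalyticAt ℝ p θ0) :
    ∃ u : ℝ → ℝ, AnalyticAt ℝ u θ0 ∧ (∀ θ,
      Real.cos (θ + (θ - θ0) ^ 2 * p θ) = (θ - θ0) * u θ) ∧ u θ0 = - Real.sin θ0 := by
  obtain ⟨r, hr, hr1, h2⟩ := factor_aux
    (fun θ => Real.cos (θ + (θ - θ0) ^ 2 * p θ)) θ0 (by fun_prop) (by simp [hcos])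
  refine ⟨r, hr, hr1, ?_⟩
  rw [h2]
  have h3 : HasDerivAt (fun θ => (θ - θ0) ^ 2 * p θ) 0 θ0 := by
    have := (((hasDerivAt_id θ0).sub_const θ0).pow 2).mul hp.differentiableAt.hasDerivAt
    refine this.congr_deriv ?_
    simp
  have := ((hasDerivAt_id θ0).add h3).cos
  have e := this.deriv
  simpa using e

lemma key (n : ℕ) (c φ θ0 : ℝ) (hcos : Real.cos θ0 = 0) (p q : ℝ → ℝ) (hp : AnalyticAt ℝ p θ0)
    (hq : AnalyticAt ℝ q θ0) (hf : ∀ᶠ θ in 𝓝 θ0, fc c θ = θ + (θ - θ0) ^ 2 * p θ)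
    (hg : ∀ᶠ θ in 𝓝 θ0, gc c θ = θ + (θ - θ0) ^ 2 * q θ) :
    Tendsto (fun θ : ℝ => deriv (fun t => ρc n c t φ) θ / Real.cos θ) (𝓝[≠] θ0) (𝓝 1) ∧
      Tendsto (fun θ : ℝ => deriv (fun ψ => ρc n c θ ψ) φ / Real.cos θ ^ 2) (𝓝[≠] θ0) (𝓝 0) ∧
      Tendsto (fun θ : ℝ => deriv (fun t => deriv (fun ψ => ρc n c t ψ) φ) θ / Real.cos θ)
        (𝓝[≠] θ0) (𝓝 0) ∧
      Tendsto (fun θ : ℝ => deriv (fun ψ => deriv (fun ψ' => ρc n c θ ψ') ψ) φ / Real.cos θ ^ 2)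
        (𝓝[≠] θ0) (𝓝 0) := by
  have hsin : Real.sin θ0 ≠ 0 := by
    intro h
    have := Real.cos_sq_add_sin_sq θ0
    rw [h, hcos] at this; norm_num at this
  obtain ⟨w, hw, hw1⟩ := D_aux θ0 hcos p q hp hq
  obtain ⟨u, hu, hu1, hu0⟩ := cos_aux θ0 hcos p hp
  obtain ⟨v, hv, hv1, hv0⟩ := cos_aux θ0 hcos q hq
  obtain ⟨k, hk, hk1, hk0⟩ := cos_aux θ0 hcos 0 analyticAt_const
  have hk1 : ∀ θ, Real.cos θ = (θ - θ0) * k θ := by simpa using hk1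
  have hk00 : k θ0 ≠ 0 := by rw [hk0]; simpa using hsin
  have hu00 : u θ0 ≠ 0 := by rw [hu0]; simpa using hsin
  have hv00 : v θ0 ≠ 0 := by rw [hv0]; simpa using hsin
  have hue : ∀ᶠ θ in 𝓝 θ0, u θ ≠ 0 := hu.continuousAt.eventually_ne hu00
  have hve : ∀ᶠ θ in 𝓝 θ0, v θ ≠ 0 := hv.continuousAt.eventually_ne hv00
  have hke : ∀ᶠ θ in 𝓝 θ0, k θ ≠ 0 := hk.continuousAt.eventually_ne hk00
  have hne : ∀ᶠ θ in 𝓝[≠] θ0, θ ≠ θ0 := eventually_mem_nhdsWithin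
  have hd0 : ∀ ψ, dd n (u θ0 ^ 2) (v θ0 ^ 2) ψ ≠ 0 := fun ψ =>
    (dd_pos n _ _ ψ (by positivity) (by positivity)).ne'
  have hdA : AnalyticAt ℝ (fun θ => dd n (u θ ^ 2) (v θ ^ 2) φ) θ0 := by
    unfold dd; fun_prop
  have hA0A : AnalyticAt ℝ (fun θ => A0 n (u θ ^ 2) (v θ ^ 2) φ) θ0 := by
    unfold A0
    exact AnalyticAt.div (by fun_prop) hdA (hd0 φ)
  have hA1A : AnalyticAt ℝ (fun θ => A1 n (u θ ^ 2) (v θ ^ 2) φ) θ0 := by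
    unfold A1
    exact AnalyticAt.div (by fun_prop) (hdA.pow 2) (pow_ne_zero 2 (hd0 φ))
  have hA2A : AnalyticAt ℝ (fun θ => A2 n (u θ ^ 2) (v θ ^ 2) φ) θ0 := by
    unfold A2
    exact AnalyticAt.div (by fun_prop) ((hdA.pow 2).pow 2) (pow_ne_zero 2 (pow_ne_zero 2 (hd0 φ)))
  -- the formula for ρ
  have hρ : ∀ᶠ θ in 𝓝[≠] θ0, ∀ ψ, ρc n c θ ψ = Real.sin (θ + (θ - θ0) ^ 2 * q θ)
      + A0 n (u θ ^ 2) (v θ ^ 2) ψ * ((θ - θ0) ^ 3 * w θ) := by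
    filter_upwards [hne, hf.filter_mono nhdsWithin_le_nhds, hg.filter_mono nhdsWithin_le_nhds]
      with θ h1 h2 h3 ψ
    have ht : (θ - θ0) ^ 2 ≠ 0 := pow_ne_zero 2 (sub_ne_zero.mpr h1)
    have ha : ac n c θ ψ = A0 n (u θ ^ 2) (v θ ^ 2) ψ := by
      unfold ac A0 dd
      rw [h2, h3, hu1, hv1, ← mul_div_mul_left (cos (n * ψ / 2) ^ 2 * u θ ^ 2) _ ht]
      congr 1 <;> ring
    rw [ρc, ha, h2, h3, ← hw1]
    ring
  have hρ' : ∀ᶠ θ in 𝓝[≠] θ0, ∀ ψ, deriv (fun ψ => ρc n c θ ψ) ψ =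
      (θ - θ0) ^ 3 * (A1 n (u θ ^ 2) (v θ ^ 2) ψ * w θ) := by
    filter_upwards [hρ, hue.filter_mono nhdsWithin_le_nhds, hve.filter_mono nhdsWithin_le_nhds]
      with θ h1 h2 h3 ψ
    have e : (fun ψ => ρc n c θ ψ) = fun ψ => Real.sin (θ + (θ - θ0) ^ 2 * q θ)
      + A0 n (u θ ^ 2) (v θ ^ 2) ψ * ((θ - θ0) ^ 3 * w θ) := funext h1
    rw [e, (((hA0 n _ _ ψ (by positivity) (by positivity)).mul_const _).const_add _).deriv]
    ring
  have hρ'' : ∀ᶠ θ in 𝓝[≠] θ0, deriv (fun ψ => deriv (fun ψ' => ρc n c θ ψ') ψ) φ =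
      (θ - θ0) ^ 3 * (A2 n (u θ ^ 2) (v θ ^ 2) φ * w θ) := by
    filter_upwards [hρ', hue.filter_mono nhdsWithin_le_nhds, hve.filter_mono nhdsWithin_le_nhds]
      with θ h1 h2 h3
    have e : (fun ψ => deriv (fun ψ' => ρc n c θ ψ') ψ) = fun ψ =>
      (θ - θ0) ^ 3 * (A1 n (u θ ^ 2) (v θ ^ 2) ψ * w θ) := funext h1
    rw [e, (((hA1 n _ _ φ (by positivity) (by positivity)).mul_const _).const_mul _).deriv]
  -- general limits
  have G1 : ∀ h : ℝ → ℝ, AnalyticAt ℝ h θ0 →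
      Tendsto (fun θ => (θ - θ0) ^ 3 * h θ / Real.cos θ ^ 2) (𝓝[≠] θ0) (𝓝 0) := by
    intro h hh
    have hc : ContinuousAt (fun θ => (θ - θ0) * h θ / k θ ^ 2) θ0 :=
      ContinuousAt.div (by have := hh.continuousAt; fun_prop) (hk.continuousAt.pow 2)
        (pow_ne_zero 2 hk00)
    have hc' : Tendsto (fun θ => (θ - θ0) * h θ / k θ ^ 2) (𝓝[≠] θ0) (𝓝 0) := by
      have := hc.tendsto.mono_left (nhdsWithin_le_nhds (s := {θ0}ᶜ))
      simpa using this
    refine hc'.congr' ?_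
    filter_upwards [hne, hke.filter_mono nhdsWithin_le_nhds] with θ h1 h2
    have := sub_ne_zero.mpr h1
    rw [hk1]
    field_simp
  have dform : ∀ h : ℝ → ℝ, AnalyticAt ℝ h θ0 → ∀ᶠ θ in 𝓝[≠] θ0,
      HasDerivAt (fun θ => (θ - θ0) ^ 3 * h θ)
        (3 * (θ - θ0) ^ 2 * h θ + (θ - θ0) ^ 3 * deriv h θ) θ := by
    intro h hh
    filter_upwards [hh.eventually_analyticAt.filter_mono nhdsWithin_le_nhds] with θ h1
    have := (((hasDerivAt_id θ).sub_const θ0).pow 3).mul h1.differentiableAt.hasDerivAt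
    refine this.congr_deriv ?_
    simp
  have G2 : ∀ h : ℝ → ℝ, AnalyticAt ℝ h θ0 →
      Tendsto (fun θ => (3 * (θ - θ0) ^ 2 * h θ + (θ - θ0) ^ 3 * deriv h θ) / Real.cos θ)
        (𝓝[≠] θ0) (𝓝 0) := by
    intro h hh
    have hc : ContinuousAt (fun θ => (3 * (θ - θ0) * h θ + (θ - θ0) ^ 2 * deriv h θ) / k θ) θ0 :=
      ContinuousAt.div (by have := hh.continuousAt; have := hh.deriv.continuousAt; fun_prop)
        hk.continuousAt hk00
    have hc' : Tendsto (fun θ => (3 * (θ - θ0) * h θ + (θ - θ0) ^ 2 * deriv h θ) / k θ)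
        (𝓝[≠] θ0) (𝓝 0) := by
      have := hc.tendsto.mono_left (nhdsWithin_le_nhds (s := {θ0}ᶜ))
      simpa using this
    refine hc'.congr' ?_
    filter_upwards [hne, hke.filter_mono nhdsWithin_le_nhds] with θ h1 h2
    have := sub_ne_zero.mpr h1
    rw [hk1]
    field_simp
  -- equality on punctured neighbourhoods of nearby points
  have lift : ∀ P : ℝ → Prop, (∀ᶠ θ in 𝓝[≠] θ0, P θ) → ∀ᶠ θ in 𝓝[≠] θ0, ∀ᶠ t in 𝓝 θ, P t := by
    intro P hP
    have h := (eventually_eventually_nhdsWithin (s := {θ0}ᶜ) (a := θ0)).mpr hP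
    filter_upwards [h, hne] with θ h1 h2
    rwa [IsOpen.nhdsWithin_eq isOpen_compl_singleton (by simpa using h2)] at h1
  refine ⟨?_, ?_, ?_, ?_⟩
  · have hh : AnalyticAt ℝ (fun θ => A0 n (u θ ^ 2) (v θ ^ 2) φ * w θ) θ0 := hA0A.mul hw
    have hgc : ContinuousAt (fun θ => v θ * (1 + (2 * (θ - θ0) * q θ + (θ - θ0) ^ 2 * deriv q θ))
        / k θ) θ0 :=
      ContinuousAt.div (by have := hq.continuousAt; have := hq.deriv.continuousAt
                           have := hv.continuousAt; fun_prop)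
        hk.continuousAt hk00
    have hgt := hgc.tendsto.mono_left (nhdsWithin_le_nhds (s := {θ0}ᶜ))
    have hlim := hgt.add (G2 _ hh)
    have e1 : v θ0 * (1 + (2 * (θ0 - θ0) * q θ0 + (θ0 - θ0) ^ 2 * deriv q θ0)) / k θ0 + 0 = 1 := by
      rw [hv0, hk0]; simp [hsin]
    rw [e1] at hlim
    refine hlim.congr' ?_
    filter_upwards [hne, hke.filter_mono nhdsWithin_le_nhds, lift _ hρ, dform _ hh,
      hq.eventually_analyticAt.filter_mono nhdsWithin_le_nhds] with θ h1 h2 h3 h4 h5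
    have e : (fun t => ρc n c t φ) =ᶠ[𝓝 θ] fun θ => Real.sin (θ + (θ - θ0) ^ 2 * q θ)
      + (θ - θ0) ^ 3 * (A0 n (u θ ^ 2) (v θ ^ 2) φ * w θ) := by
      filter_upwards [h3] with t ht
      rw [ht φ]; ring
    have hqd : HasDerivAt (fun θ => θ + (θ - θ0) ^ 2 * q θ)
        (1 + (2 * (θ - θ0) * q θ + (θ - θ0) ^ 2 * deriv q θ)) θ := by
      have := (hasDerivAt_id θ).add
        ((((hasDerivAt_id θ).sub_const θ0).pow 2).mul h5.differentiableAt.hasDerivAt)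
      refine this.congr_deriv ?_
      simp
    rw [e.deriv_eq, (hqd.sin.fun_add h4).deriv, hv1, hk1]
    have := sub_ne_zero.mpr h1
    field_simp
  · refine (G1 _ (hA1A.mul hw)).congr' ?_
    filter_upwards [hρ'] with θ h
    rw [h φ]; rfl
  · refine (G2 _ (hA1A.mul hw)).congr' ?_
    filter_upwards [lift _ hρ', dform _ (hA1A.mul hw)] with θ h3 h4
    have e : (fun t => deriv (fun ψ => ρc n c t ψ) φ) =ᶠ[𝓝 θ] fun θ => 
      (θ - θ0) ^ 3 * (A1 n (u θ ^ 2) (v θ ^ 2) φ * w θ) := by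
      filter_upwards [h3] with t ht
      exact ht φ
    rw [e.deriv_eq]
    congr 1
    exact h4.deriv.symm
  · refine (G1 _ (hA2A.mul hw)).congr' ?_
    filter_upwards [hρ''] with θ h
    rw [h]; rfl

lemma Fc_eq (c x : ℝ) (h1 : c + x ≠ 0) (h2 : c * x + (1 - c) * (1 - x) ^ 2 ≠ 0) :
    Fc c x = x - (1 - c) * (1 - x) ^ 2 * x ^ 2 / ((c + x) * (c * x + (1 - c) * (1 - x) ^ 2)) := by
  unfold Fc
  field_simp
  ring

lemma fc_right (c : ℝ) (hc : c ∈ Set.Ioo (0 : ℝ) 1) : ∃ p : ℝ → ℝ, AnalyticAt ℝ p (π / 2) ∧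
    ∀ᶠ θ in 𝓝 (π / 2), fc c θ = θ + (θ - π / 2) ^ 2 * p θ := by
  obtain ⟨h0, h1⟩ := hc
  have hpi := Real.pi_ne_zero
  have hx : π / 2 / π + 1 / 2 = 1 := by field_simp; norm_num
  have k1 : c + (π / 2 / π + 1 / 2) ≠ 0 := by rw [hx]; positivity
  have k2 : c * (π / 2 / π + 1 / 2) + (1 - c) * (1 - (π / 2 / π + 1 / 2)) ^ 2 ≠ 0 := by
    rw [hx]; simpa using h0.ne'
  refine ⟨fun θ => -(1 - c) * (θ / π + 1 / 2) ^ 2 / ((c + (θ / π + 1 / 2)) *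
    (c * (θ / π + 1 / 2) + (1 - c) * (1 - (θ / π + 1 / 2)) ^ 2)) / π, ?_, ?_⟩
  · refine AnalyticAt.fun_div (AnalyticAt.fun_div (by fun_prop) ?_ (mul_ne_zero k1 k2))
      analyticAt_const hpi
    fun_prop
  · have c1 : ContinuousAt (fun θ : ℝ => c + (θ / π + 1 / 2)) (π / 2) := by fun_prop
    have c2 : ContinuousAt (fun θ : ℝ => c * (θ / π + 1 / 2) +
      (1 - c) * (1 - (θ / π + 1 / 2)) ^ 2) (π / 2) := by fun_prop
    filter_upwards [c1.eventually_ne k1, c2.eventually_ne k2] with θ e1 e2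
    rw [fc, Fc_eq _ _ e1 e2]
    generalize hy : θ / π + 1 / 2 = x at *
    have : θ = π * x - π / 2 := by rw [← hy]; field_simp; ring
    subst this
    field_simp
    ring

lemma fc_left (c : ℝ) (hc : c ∈ Set.Ioo (0 : ℝ) 1) : ∃ p : ℝ → ℝ, AnalyticAt ℝ p (-(π / 2)) ∧
    ∀ᶠ θ in 𝓝 (-(π / 2)), fc c θ = θ + (θ - -(π / 2)) ^ 2 * p θ := by
  obtain ⟨h0, h1⟩ := hc
  have hpi := Real.pi_ne_zero
  have hx : -(π / 2) / π + 1 / 2 = 0 := by field_simp; norm_num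
  have k1 : c + (-(π / 2) / π + 1 / 2) ≠ 0 := by rw [hx]; simpa using h0.ne'
  have k2 : c * (-(π / 2) / π + 1 / 2) + (1 - c) * (1 - (-(π / 2) / π + 1 / 2)) ^ 2 ≠ 0 := by
    rw [hx]; simpa using (sub_pos.mpr h1).ne'
  refine ⟨fun θ => -(1 - c) * (1 - (θ / π + 1 / 2)) ^ 2 / ((c + (θ / π + 1 / 2)) *
    (c * (θ / π + 1 / 2) + (1 - c) * (1 - (θ / π + 1 / 2)) ^ 2)) / π, ?_, ?_⟩
  · refine AnalyticAt.fun_div (AnalyticAt.fun_div (by fun_prop) ?_ (mul_ne_zero k1 k2))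
      analyticAt_const hpi
    fun_prop
  · have c1 : ContinuousAt (fun θ : ℝ => c + (θ / π + 1 / 2)) (-(π / 2)) := by fun_prop
    have c2 : ContinuousAt (fun θ : ℝ => c * (θ / π + 1 / 2) +
      (1 - c) * (1 - (θ / π + 1 / 2)) ^ 2) (-(π / 2)) := by fun_prop
    filter_upwards [c1.eventually_ne k1, c2.eventually_ne k2] with θ e1 e2
    rw [fc, Fc_eq _ _ e1 e2]
    generalize hy : θ / π + 1 / 2 = x at *
    have : θ = π * x - π / 2 := by rw [← hy]; field_simp; ring
    subst this
    field_simp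
    ring

lemma gc_of (c a : ℝ) (h : ∃ p : ℝ → ℝ, AnalyticAt ℝ p (-a) ∧
    ∀ᶠ θ in 𝓝 (-a), fc c θ = θ + (θ - -a) ^ 2 * p θ) :
    ∃ q : ℝ → ℝ, AnalyticAt ℝ q a ∧
    ∀ᶠ θ in 𝓝 a, gc c θ = θ + (θ - a) ^ 2 * q θ := by
  obtain ⟨p, hp, h⟩ := h
  refine ⟨fun θ => - p (-θ), (AnalyticAt.fun_comp (g := p) (f := fun θ => -θ) hp (by fun_prop)).neg, ?_⟩
  have ht : Tendsto (fun θ : ℝ => -θ) (𝓝 a) (𝓝 (-a)) := continuous_neg.tendsto a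
  filter_upwards [ht.eventually h] with θ e
  rw [gc, e]; ring

theorem stmt_12 (n : ℕ) (hn : 2 ≤ n) (c : ℝ) (hc : c ∈ Set.Ioo (0 : ℝ) 1) (φ : ℝ) :
    (Tendsto (fun θ : ℝ => deriv (fun t => ρc n c t φ) θ / Real.cos θ) (𝓝[<] (π / 2)) (𝓝 1) ∧
      Tendsto (fun θ : ℝ => deriv (fun ψ => ρc n c θ ψ) φ / Real.cos θ ^ 2) (𝓝[<] (π / 2)) (𝓝 0) ∧
      Tendsto (fun θ : ℝ => deriv (fun t => deriv (fun ψ => ρc n c t ψ) φ) θ / Real.cos θ)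
        (𝓝[<] (π / 2)) (𝓝 0) ∧
      Tendsto (fun θ : ℝ => deriv (fun ψ => deriv (fun ψ' => ρc n c θ ψ') ψ) φ / Real.cos θ ^ 2)
        (𝓝[<] (π / 2)) (𝓝 0)) ∧
    (Tendsto (fun θ : ℝ => deriv (fun t => ρc n c t φ) θ / Real.cos θ) (𝓝[>] (-(π / 2))) (𝓝 1) ∧
      Tendsto (fun θ : ℝ => deriv (fun ψ => ρc n c θ ψ) φ / Real.cos θ ^ 2)
        (𝓝[>] (-(π / 2))) (𝓝 0) ∧
      Tendsto (fun θ : ℝ => deriv (fun t => deriv (fun ψ => ρc n c t ψ) φ) θ / Real.cos θ)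
        (𝓝[>] (-(π / 2))) (𝓝 0) ∧
      Tendsto (fun θ : ℝ => deriv (fun ψ => deriv (fun ψ' => ρc n c θ ψ') ψ) φ / Real.cos θ ^ 2)
        (𝓝[>] (-(π / 2))) (𝓝 0)) := by

  obtain ⟨p, hp, hf⟩ := fc_right c hc
  obtain ⟨p', hp', hf'⟩ := fc_left c hc
  obtain ⟨q, hq, hg⟩ := gc_of c (π / 2) (fc_left c hc)
  obtain ⟨q', hq', hg'⟩ := gc_of c (-(π / 2)) (by rw [neg_neg]; exact fc_right c hc)
  obtain ⟨a1, a2, a3, a4⟩ := key n c φ (π / 2) (by simp) p q hp hq hf hg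
  obtain ⟨b1, b2, b3, b4⟩ := key n c φ (-(π / 2)) (by simp) p' q' hp' hq' hf' hg'
  have l1 : 𝓝[<] (π / 2) ≤ 𝓝[≠] (π / 2) := nhdsWithin_mono _ fun x hx => ne_of_lt hx
  have l2 : 𝓝[>] (-(π / 2)) ≤ 𝓝[≠] (-(π / 2)) := nhdsWithin_mono _ fun x hx => ne_of_gt hx
  exact ⟨⟨a1.mono_left l1, a2.mono_left l1, a3.mono_left l1, a4.mono_left l1⟩,
    ⟨b1.mono_left l2, b2.mono_left l2, b3.mono_left l2, b4.mono_left l2⟩⟩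
end

section
/- Fix an integer n ≥ 2 and c ∈ (0,1). For every θ ∈ (−π/2, π/2) and every φ ∈ ℝ, at least one of the partial derivatives (∂ρ_c/∂θ)(θ,φ) and (∂ρ_c/∂φ)(θ,φ) is nonzero; more precisely, if (∂ρ_c/∂φ)(θ,φ) = 0 and φ is an integer multiple of π/n, then (∂ρ_c/∂θ)(θ,φ) > 0. (This expresses that the only equilibrium points of the body K_n(c,d) with respect to the origin are the two poles.) -/
open Real Set Filter Topology

/-- The derivative numerator of `Fc` is positive (Bernstein expansion). -/
lemma numer_pos (c x : ℝ) (hc : 0 < c) (hc1 : c < 1) (hx : 0 < x) (hx1 : x < 1) :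
    0 < (3 * x ^ 2 + 2 * c * x + (1 - c) * (1 - x) ^ 2 - 2 * (1 - c) * x * (1 - x)) *
        ((c + x) * (c * x + (1 - c) * (1 - x) ^ 2)) -
      (x * (x * (c + x) + (1 - c) * (1 - x) ^ 2)) *
        ((c * x + (1 - c) * (1 - x) ^ 2) + (c + x) * (c - 2 * (1 - c) * (1 - x))) := by
  obtain ⟨y, hy⟩ : ∃ y, y = 1 - x := ⟨_, rfl⟩
  obtain ⟨e, he⟩ : ∃ e, e = 1 - c := ⟨_, rfl⟩
  have hy0 : 0 < y := by linarith
  have he0 : 0 < e := by linarith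
  have key : 0 < y ^ 4 * c * e ^ 2 + 2 * x * y ^ 3 * c ^ 2 * e + 3 * x ^ 2 * y ^ 2 * c * e ^ 2
      + 5 * x ^ 2 * y ^ 2 * c ^ 2 * e + x ^ 2 * y ^ 2 * c ^ 3 + 2 * x ^ 3 * y * e ^ 3
      + 6 * x ^ 3 * y * c * e ^ 2 + 6 * x ^ 3 * y * c ^ 2 * e + 4 * x ^ 3 * y * c ^ 3
      + x ^ 4 * c * e ^ 2 + 4 * x ^ 4 * c ^ 2 * e + 4 * x ^ 4 * c ^ 3 := by positivity
  rw [hy, he] at key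
  refine lt_of_lt_of_eq key ?_
  ring

lemma Fc_bounds (c x : ℝ) (hc : 0 < c) (hc1 : c < 1) (hx : 0 < x) (hx1 : x < 1) :
    0 < Fc c x ∧ Fc c x < x := by
  have he : 0 < 1 - c := by linarith
  have hy : 0 < 1 - x := by linarith
  have hw : 0 < (1 - c) * (1 - x) ^ 2 := by positivity
  have hlt : c * x / (c + x) < x := by
    rw [div_lt_iff₀ (by positivity)]; nlinarith [mul_pos hx hx]
  unfold Fc
  refine ⟨by positivity, ?_⟩
  rw [div_lt_iff₀ (by positivity)]
  nlinarith [mul_lt_mul_of_pos_left hlt hw]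

lemma Fc_deriv (c x : ℝ) (hc : 0 < c) (hc1 : c < 1) (hx : 0 < x) (hx1 : x < 1) :
    ∃ F', 0 < F' ∧ HasDerivAt (Fc c) F' x := by
  have he : 0 < 1 - c := by linarith
  have hy : 0 < 1 - x := by linarith
  have hD : 0 < (c + x) * (c * x + (1 - c) * (1 - x) ^ 2) := by positivity
  have hev : Fc c =ᶠ[𝓝 x] fun z => c * ((z * (z * (c + z) + (1 - c) * (1 - z) ^ 2)) /
      ((c + z) * (c * z + (1 - c) * (1 - z) ^ 2))) := by
    filter_upwards [Ioo_mem_nhds hx hx1] with z hz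
    have hz0 : 0 < z := hz.1
    have hz1 : 0 < 1 - z := by linarith [hz.2]
    have h1 : c + z ≠ 0 := by positivity
    have h2 : c * z + (1 - c) * (1 - z) ^ 2 ≠ 0 := by positivity
    unfold Fc
    field_simp
  have hsq : HasDerivAt (fun z : ℝ => (1 - c) * (1 - z) ^ 2) (-(2 * (1 - c) * (1 - x))) x := by
    have := (((hasDerivAt_id x).const_sub 1).pow 2).const_mul (1 - c)
    refine this.congr_deriv ?_
    simp only [id, Pi.add_apply, Pi.mul_apply]
    ring
  have hN : HasDerivAt (fun z : ℝ => z * (z * (c + z) + (1 - c) * (1 - z) ^ 2))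
      (3 * x ^ 2 + 2 * c * x + (1 - c) * (1 - x) ^ 2 - 2 * (1 - c) * x * (1 - x)) x := by
    have := (hasDerivAt_id x).mul
      (((hasDerivAt_id x).mul ((hasDerivAt_id x).const_add c)).add hsq)
    refine this.congr_deriv ?_
    simp only [id, Pi.add_apply, Pi.mul_apply]
    ring
  have hDd : HasDerivAt (fun z : ℝ => (c + z) * (c * z + (1 - c) * (1 - z) ^ 2))
      ((c * x + (1 - c) * (1 - x) ^ 2) + (c + x) * (c - 2 * (1 - c) * (1 - x))) x := by
    have := ((hasDerivAt_id x).const_add c).mul (((hasDerivAt_id x).const_mul c).add hsq)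
    refine this.congr_deriv ?_
    simp only [id, Pi.add_apply, Pi.mul_apply]
    ring
  refine ⟨_, ?_, ((hN.div hDd hD.ne').const_mul c).congr_of_eventuallyEq hev⟩
  exact mul_pos hc (div_pos (numer_pos c x hc hc1 hx hx1) (by positivity))

lemma x_mem (θ : ℝ) (hθ : θ ∈ Set.Ioo (-(π / 2)) (π / 2)) :
    0 < θ / π + 1 / 2 ∧ θ / π + 1 / 2 < 1 := by
  have hp := Real.pi_pos
  have h1 : -(1 / 2) < θ / π := by rw [lt_div_iff₀ hp]; linarith [hθ.1]
  have h2 : θ / π < 1 / 2 := by rw [div_lt_iff₀ hp]; linarith [hθ.2]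
  constructor <;> linarith

lemma fc_bounds (c θ : ℝ) (hc : c ∈ Set.Ioo (0 : ℝ) 1) (hθ : θ ∈ Set.Ioo (-(π / 2)) (π / 2)) :
    -(π / 2) < fc c θ ∧ fc c θ < θ := by
  have hp := Real.pi_pos
  obtain ⟨h0, h1⟩ := x_mem θ hθ
  obtain ⟨a, b⟩ := Fc_bounds c _ hc.1 hc.2 h0 h1
  unfold fc
  have e : π * (θ / π + 1 / 2) = θ + π / 2 := by field_simp
  constructor
  · linarith [mul_pos hp a]
  · linarith [mul_lt_mul_of_pos_left b hp]

lemma neg_mem (θ : ℝ) (hθ : θ ∈ Set.Ioo (-(π / 2)) (π / 2)) :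
    -θ ∈ Set.Ioo (-(π / 2)) (π / 2) := ⟨by linarith [hθ.2], by linarith [hθ.1]⟩

lemma gc_bounds (c θ : ℝ) (hc : c ∈ Set.Ioo (0 : ℝ) 1) (hθ : θ ∈ Set.Ioo (-(π / 2)) (π / 2)) :
    θ < gc c θ ∧ gc c θ < π / 2 := by
  obtain ⟨a, b⟩ := fc_bounds c (-θ) hc (neg_mem θ hθ)
  unfold gc
  constructor <;> linarith

lemma cosf_pos (c θ : ℝ) (hc : c ∈ Set.Ioo (0 : ℝ) 1) (hθ : θ ∈ Set.Ioo (-(π / 2)) (π / 2)) :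
    0 < Real.cos (fc c θ) := by
  obtain ⟨a, b⟩ := fc_bounds c θ hc hθ
  exact Real.cos_pos_of_mem_Ioo ⟨a, b.trans hθ.2⟩

lemma cosg_pos (c θ : ℝ) (hc : c ∈ Set.Ioo (0 : ℝ) 1) (hθ : θ ∈ Set.Ioo (-(π / 2)) (π / 2)) :
    0 < Real.cos (gc c θ) := by
  obtain ⟨a, b⟩ := gc_bounds c θ hc hθ
  exact Real.cos_pos_of_mem_Ioo ⟨hθ.1.trans a, b⟩

lemma fc_deriv (c θ : ℝ) (hc : c ∈ Set.Ioo (0 : ℝ) 1) (hθ : θ ∈ Set.Ioo (-(π / 2)) (π / 2)) :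
    ∃ F', 0 < F' ∧ HasDerivAt (fc c) F' θ := by
  obtain ⟨h0, h1⟩ := x_mem θ hθ
  obtain ⟨F', hF, hd⟩ := Fc_deriv c _ hc.1 hc.2 h0 h1
  have hl : HasDerivAt (fun t : ℝ => t / π + 1 / 2) (1 / π) θ :=
    ((hasDerivAt_id θ).div_const π).add_const _
  have := ((HasDerivAt.comp θ hd hl).const_mul π).sub_const (π / 2)
  have hp := Real.pi_pos
  exact ⟨π * (F' * (1 / π)), by positivity, this⟩

lemma gc_deriv (c θ : ℝ) (hc : c ∈ Set.Ioo (0 : ℝ) 1) (hθ : θ ∈ Set.Ioo (-(π / 2)) (π / 2)) :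
    ∃ F', 0 < F' ∧ HasDerivAt (gc c) F' θ := by
  obtain ⟨F', hF, hd⟩ := fc_deriv c (-θ) hc (neg_mem θ hθ)
  have := (HasDerivAt.comp θ hd (hasDerivAt_neg θ)).neg
  exact ⟨F', hF, this.congr_deriv (by ring)⟩

lemma theta_pos (n : ℕ) (c : ℝ) (hc : c ∈ Set.Ioo (0 : ℝ) 1)
    (θ : ℝ) (hθ : θ ∈ Set.Ioo (-(π / 2)) (π / 2)) (φ : ℝ)
    (h : Real.sin (n * φ / 2) = 0 ∨ Real.cos (n * φ / 2) = 0) :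
    0 < deriv (fun t => ρc n c t φ) θ := by
  have hnh : Set.Ioo (-(π / 2)) (π / 2) ∈ 𝓝 θ := Ioo_mem_nhds hθ.1 hθ.2
  have hsc := Real.sin_sq_add_cos_sq (n * φ / 2)
  rcases h with h | h
  · have hC : Real.cos (n * φ / 2) ^ 2 = 1 := by rw [h] at hsc; linarith
    have hev : (fun t => ρc n c t φ) =ᶠ[𝓝 θ] fun t => Real.sin (fc c t) := by
      filter_upwards [hnh] with t ht
      have := (cosf_pos c t hc ht).ne'
      simp [ρc, ac, hC, h, this]
    obtain ⟨F', hF, hd⟩ := fc_deriv c θ hc hθ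
    rw [hev.deriv_eq, hd.sin.deriv]
    exact mul_pos (cosf_pos c θ hc hθ) hF
  · have hev : (fun t => ρc n c t φ) =ᶠ[𝓝 θ] fun t => Real.sin (gc c t) := by
      filter_upwards [hnh] with t ht
      simp [ρc, ac, h]
    obtain ⟨F', hF, hd⟩ := gc_deriv c θ hc hθ
    rw [hev.deriv_eq, hd.sin.deriv]
    exact mul_pos (cosg_pos c θ hc hθ) hF

lemma phi_zero (n : ℕ) (hn : 2 ≤ n) (c : ℝ) (hc : c ∈ Set.Ioo (0 : ℝ) 1)
    (θ : ℝ) (hθ : θ ∈ Set.Ioo (-(π / 2)) (π / 2)) (φ : ℝ)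
    (h : deriv (fun ψ => ρc n c θ ψ) φ = 0) :
    Real.sin (n * φ / 2) = 0 ∨ Real.cos (n * φ / 2) = 0 := by
  have hA := cosf_pos c θ hc hθ
  have hB := cosg_pos c θ hc hθ
  obtain ⟨f1, f2⟩ := fc_bounds c θ hc hθ
  obtain ⟨g1, g2⟩ := gc_bounds c θ hc hθ
  have huv : Real.sin (fc c θ) < Real.sin (gc c θ) :=
    Real.sin_lt_sin_of_lt_of_le_pi_div_two f1.le g2.le (f2.trans g1)
  have hn0 : (0 : ℝ) < n := by exact_mod_cast (by omega : 0 < n)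
  unfold ρc ac at h
  generalize Real.cos (fc c θ) = A at *
  generalize Real.cos (gc c θ) = B at *
  generalize Real.sin (fc c θ) = u at *
  generalize Real.sin (gc c θ) = v at *
  have hl : HasDerivAt (fun ψ : ℝ => (n : ℝ) * ψ / 2) (n / 2 : ℝ) φ := by
    simpa using ((hasDerivAt_id φ).const_mul (n : ℝ)).div_const 2
  have hsc := Real.sin_sq_add_cos_sq (n * φ / 2)
  have hC := (hl.cos.pow 2).mul_const (A ^ 2)
  have hS := (hl.sin.pow 2).mul_const (B ^ 2)
  have hden : 0 < Real.cos (n * φ / 2) ^ 2 * A ^ 2 + Real.sin (n * φ / 2) ^ 2 * B ^ 2 := by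
    by_cases h0 : Real.sin (n * φ / 2) = 0
    · have : Real.cos (n * φ / 2) ^ 2 = 1 := by rw [h0] at hsc; linarith
      rw [this]; positivity
    · positivity
  have ha := hC.div (hC.add hS) hden.ne'
  have hr := (ha.mul_const u).add ((ha.const_sub 1).mul_const v)
  have h' := hr.deriv.symm.trans h
  simp only [Pi.add_apply, Pi.pow_apply] at h'
  generalize Real.sin (n * φ / 2) = s at *
  generalize Real.cos (n * φ / 2) = k at *
  have e : (n : ℝ) * s * k * (A ^ 2 * B ^ 2) * (v - u) /
      (k ^ 2 * A ^ 2 + s ^ 2 * B ^ 2) ^ 2 = 0 := by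
    have hne := hden.ne'
    rw [← h']
    have h1 : (n : ℝ) * s * k * (A ^ 2 * B ^ 2) * (v - u) =
        (n : ℝ) * s * k * (A ^ 2 * B ^ 2) * (v - u) * (s ^ 2 + k ^ 2) := by rw [hsc, mul_one]
    rw [h1]
    generalize hq : (k ^ 2 * A ^ 2 + s ^ 2 * B ^ 2) = q at *
    field_simp
    rw [← hq]
    push_cast
    ring
  have hvu : v - u ≠ 0 := (sub_pos.2 huv).ne'
  rw [div_eq_zero_iff] at e
  have := hden.ne'
  simp only [mul_eq_zero, pow_eq_zero_iff, ne_eq, OfNat.ofNat_ne_zero, not_false_eq_true,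
    hn0.ne', hA.ne', hB.ne', hvu, this, or_false, false_or] at e
  exact e

theorem stmt_16 (n : ℕ) (hn : 2 ≤ n) (c : ℝ) (hc : c ∈ Set.Ioo (0 : ℝ) 1)
    (θ : ℝ) (hθ : θ ∈ Set.Ioo (-(π / 2)) (π / 2)) (φ : ℝ) :
    (deriv (fun t => ρc n c t φ) θ ≠ 0 ∨ deriv (fun ψ => ρc n c θ ψ) φ ≠ 0) ∧
      ((deriv (fun ψ => ρc n c θ ψ) φ = 0 ∧ ∃ k : ℤ, φ = k * π / n) →
        0 < deriv (fun t => ρc n c t φ) θ) := by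
  have key : deriv (fun ψ => ρc n c θ ψ) φ = 0 → 0 < deriv (fun t => ρc n c t φ) θ :=
    fun h => theta_pos n c hc θ hθ φ (phi_zero n hn c hc θ hθ φ h)
  refine ⟨?_, fun h => key h.1⟩
  by_cases h : deriv (fun ψ => ρc n c θ ψ) φ = 0
  · exact Or.inl (key h).ne'
  · exact Or.inr h
end
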